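/- arXiv:2002.07898 — 3 statements merged into one kernel-verified Lean document; each statement's English description precedes it below -/
import Mathlib

section
/- Let m, k be positive integers, let D be a real m×k matrix, let α > 0, λ > 0, let d ∈ ℝ^k, and let ψ : ℝ^k → (−∞,+∞] be a proper lower semicontinuous convex function. Set Q = DᵀD + αI (a k×k matrix), F = Q⁻¹Dᵀ and c = Q⁻¹d. Then for every x ∈ ℝ^m and every a ∈ ℝ^k, a minimizes the function a ↦ (1/2)‖x − Da‖² + λψ(a) + (α/2)‖a‖² + dᵀa over ℝ^k if and only if a minimizes the function a ↦ (1/2)(a − (Fx − c))ᵀ Q (a − (Fx − c)) + λψ(a) over ℝ^k. In other words, the synthesis sparse-coding map M_D(x) equals the proximity operator of λψ in the metric induced by Q, evaluated at Fx − c. -/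
open Matrix

/-- The Gram matrix of `D` shifted by a positive multiple of the identity is positive definite. -/
theorem Matrix.posDef_transpose_mul_self_add_smul_one {m k : Type*} [Fintype m] [Fintype k]
    [DecidableEq k] (D : Matrix m k ℝ) {α : ℝ} (hα : 0 < α) :
    (Dᵀ * D + α • (1 : Matrix k k ℝ)).PosDef := by
  have h := Matrix.posSemidef_conjTranspose_mul_self D
  rw [Matrix.conjTranspose_eq_transpose_of_trivial] at h
  exact Matrix.PosDef.posSemidef_add h (Matrix.PosDef.one.smul hα)

/-- Completing the square: if `Q w = Dᵀ x - d` for `Q = Dᵀ D + α I`, the smooth part of the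
synthesis objective is a `Q`-weighted squared distance to `w`, up to a constant. -/
theorem Matrix.half_sq_add_eq_half_weighted_sq_add {m k : Type*} [Fintype m] [Fintype k]
    [DecidableEq k] (D : Matrix m k ℝ) (α : ℝ) (x : m → ℝ) (d w : k → ℝ)
    (hw : (Dᵀ * D + α • (1 : Matrix k k ℝ)) *ᵥ w = Dᵀ *ᵥ x - d) (b : k → ℝ) :
    1 / 2 * ((x - D *ᵥ b) ⬝ᵥ (x - D *ᵥ b)) + α / 2 * (b ⬝ᵥ b) + d ⬝ᵥ b =
      (1 / 2 * (x ⬝ᵥ x) - 1 / 2 * (w ⬝ᵥ (Dᵀ *ᵥ x - d))) +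
        1 / 2 * ((b - w) ⬝ᵥ ((Dᵀ * D + α • (1 : Matrix k k ℝ)) *ᵥ (b - w))) := by
  have hadj (u : k → ℝ) (y : m → ℝ) : u ⬝ᵥ (Dᵀ *ᵥ y) = (D *ᵥ u) ⬝ᵥ y := by
    rw [Matrix.dotProduct_mulVec, Matrix.vecMul_transpose]
  have hQ (u v : k → ℝ) : u ⬝ᵥ ((Dᵀ * D + α • (1 : Matrix k k ℝ)) *ᵥ v) =
      (D *ᵥ u) ⬝ᵥ (D *ᵥ v) + α * (u ⬝ᵥ v) := by
    rw [Matrix.add_mulVec, dotProduct_add, ← Matrix.mulVec_mulVec, hadj, Matrix.smul_mulVec,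
      Matrix.one_mulVec, dotProduct_smul, smul_eq_mul]
  have hbw := hQ b w
  have hwb := hQ w b
  rw [hw, dotProduct_sub, hadj] at hbw
  rw [dotProduct_comm (D *ᵥ w), dotProduct_comm w b] at hwb
  rw [Matrix.mulVec_sub, hw, sub_dotProduct b, dotProduct_sub b, dotProduct_sub w,
    dotProduct_sub w (_ *ᵥ b), dotProduct_sub w, hQ b b, hwb,
    dotProduct_sub b, hadj b x, dotProduct_comm d b, sub_dotProduct x, dotProduct_sub x,
    dotProduct_sub (D *ᵥ b), dotProduct_comm x (D *ᵥ b)]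
  linarith

/-- Adding a real constant to both sides does not change an inequality in `EReal`. -/
theorem EReal.coe_add_add_le_coe_add_add_iff (C p q : ℝ) (u v : EReal) :
    ((C + p : ℝ) : EReal) + u ≤ ((C + q : ℝ) : EReal) + v ↔ (p : EReal) + u ≤ (q : EReal) + v := by
  rw [EReal.coe_add, EReal.coe_add, add_assoc, add_assoc]
  refine ⟨fun h => ?_, fun h => by gcongr⟩
  have hneg := add_le_add_right h ((-C : ℝ) : EReal)
  have hcancel (z : EReal) : ((-C : ℝ) : EReal) + ((C : EReal) + z) = z := by
    rw [← add_assoc, ← EReal.coe_add, neg_add_cancel, EReal.coe_zero, zero_add]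
  rwa [hcancel, hcancel] at hneg

/-- The synthesis sparse-coding objective and the Q-metric proximal
objective at `F x - c` have the same minimizers. -/
theorem stmt_0 (m k : ℕ) (hm : 0 < m) (hk : 0 < k)
    (D : Matrix (Fin m) (Fin k) ℝ) (α lam : ℝ) (hα : 0 < α) (hlam : 0 < lam)
    (d : Fin k → ℝ) (ψ : (Fin k → ℝ) → EReal)
    (hψbot : ∀ a, ψ a ≠ ⊥) (hψproper : ∃ a, ψ a ≠ ⊤)
    (hψlsc : LowerSemicontinuous ψ)
    (hψconv : ∀ a b : Fin k → ℝ, ∀ t : ℝ, 0 ≤ t → t ≤ 1 →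
      ψ (t • a + (1 - t) • b) ≤ (t : EReal) * ψ a + ((1 - t : ℝ) : EReal) * ψ b)
    (Q : Matrix (Fin k) (Fin k) ℝ) (hQ : Q = Dᵀ * D + α • 1)
    (F : Matrix (Fin k) (Fin m) ℝ) (hF : F = Q⁻¹ * Dᵀ)
    (c : Fin k → ℝ) (hc : c = Q⁻¹ *ᵥ d)
    (x : Fin m → ℝ) (a : Fin k → ℝ) :
    (∀ b : Fin k → ℝ,
        ((1 / 2 * ((x - D *ᵥ a) ⬝ᵥ (x - D *ᵥ a)) + α / 2 * (a ⬝ᵥ a) + d ⬝ᵥ a : ℝ) : EReal)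
          + (lam : EReal) * ψ a
        ≤ ((1 / 2 * ((x - D *ᵥ b) ⬝ᵥ (x - D *ᵥ b)) + α / 2 * (b ⬝ᵥ b) + d ⬝ᵥ b : ℝ) : EReal)
          + (lam : EReal) * ψ b)
    ↔
    (∀ b : Fin k → ℝ,
        ((1 / 2 * ((a - (F *ᵥ x - c)) ⬝ᵥ (Q *ᵥ (a - (F *ᵥ x - c)))) : ℝ) : EReal)
          + (lam : EReal) * ψ a
        ≤ ((1 / 2 * ((b - (F *ᵥ x - c)) ⬝ᵥ (Q *ᵥ (b - (F *ᵥ x - c)))) : ℝ) : EReal)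
          + (lam : EReal) * ψ b) := by
  subst hQ hF hc
  have hdet := (Matrix.isUnit_iff_isUnit_det _).mp
    (Matrix.posDef_transpose_mul_self_add_smul_one D hα).isUnit
  have hsq := Matrix.half_sq_add_eq_half_weighted_sq_add D α x d
    (((Dᵀ * D + α • 1)⁻¹ * Dᵀ) *ᵥ x - (Dᵀ * D + α • 1)⁻¹ *ᵥ d) (by
      rw [Matrix.mulVec_sub, Matrix.mulVec_mulVec, Matrix.mulVec_mulVec, ← Matrix.mul_assoc,
        Matrix.mul_nonsing_inv _ hdet, Matrix.one_mul, Matrix.one_mulVec])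
  refine forall_congr' fun b => ?_
  rw [hsq a, hsq b]
  exact EReal.coe_add_add_le_coe_add_add_iff _ _ _ _ _
end

section
/- (Theorem 2) Let Q be a symmetric positive definite k×k real matrix, β > 0, λ > 0, and Z ∈ ℝ^{k×N}. Let U = prox^Q_{λψ}(Z) be the unique minimizer over ℝ^{k×N} of (1/2)tr((U−Z)ᵀQ(U−Z)) + λψ(U), where ψ(U) = ‖U‖₁ + ι_{[0,+∞)^{k×N}}(U) + (β/(2λ))‖U‖²_F. Then the entries of U satisfy, for every i ∈ {1,…,k} and j ∈ {1,…,N}: u_{i,j} = (q_{i,i}/(q_{i,i}+β)) z_{i,j} − v_{i,j} if q_{i,i} z_{i,j} > (q_{i,i}+β) v_{i,j}, and u_{i,j} = 0 otherwise, where v_{i,j} = (λ + Σ_{ℓ=1, ℓ≠i}^k q_{i,ℓ}(u_{ℓ,j} − z_{ℓ,j}))/(q_{i,i}+β). -/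
open Matrix
open scoped Classical

/-- The elastic-net-like regularizer
`ψ(U) = ‖U‖₁ + ι_{[0,∞)^{k×N}}(U) + (β/(2λ)) ‖U‖_F²`, with values in `(-∞, +∞]`. -/
noncomputable def elasticPsi (k N : ℕ) (lam β : ℝ)
    (U : Matrix (Fin k) (Fin N) ℝ) : EReal :=
  ((∑ i, ∑ j, |U i j| : ℝ) : EReal)
    + (if ∀ i j, 0 ≤ U i j then (0 : EReal) else ⊤)
    + ((β / (2 * lam) * Matrix.trace (Uᵀ * U) : ℝ) : EReal)

theorem trace_transpose_mul_mul_add_smul_single {m n : Type*} [Fintype m] [Fintype n]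
    [DecidableEq m] [DecidableEq n] {Q : Matrix m m ℝ} (hQ : Q.IsSymm) (A : Matrix m n ℝ)
    (t : ℝ) (i : m) (j : n) :
    trace ((A + t • single i j 1)ᵀ * Q * (A + t • single i j 1)) =
      trace (Aᵀ * Q * A) + 2 * t * (Q * A) i j + t ^ 2 * Q i i := by
  have h₁ : trace ((single i j (1 : ℝ))ᵀ * Q * A) = (Q * A) i j := by
    rw [Matrix.mul_assoc, transpose_single, trace_single_mul, one_smul]
  have h₂ : trace (Aᵀ * Q * single i j (1 : ℝ)) = (Q * A) i j := by
    rw [← h₁, ← trace_transpose]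
    simp only [transpose_mul, transpose_transpose, hQ.eq, Matrix.mul_assoc]
  have h₃ : trace ((single i j (1 : ℝ))ᵀ * Q * single i j (1 : ℝ)) = Q i i := by
    rw [Matrix.mul_assoc, transpose_single, trace_single_mul, one_smul]
    simp
  simp only [transpose_add, transpose_smul, Matrix.add_mul, Matrix.mul_add, trace_add,
    Matrix.smul_mul, Matrix.mul_smul, trace_smul, smul_eq_mul, h₁, h₂, h₃]
  ring

theorem sum_sum_add_smul_single {m n : Type*} [Fintype m] [Fintype n]
    [DecidableEq m] [DecidableEq n] (A : Matrix m n ℝ) (t : ℝ) (i : m) (j : n) :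
    ∑ a, ∑ b, (A + t • single i j (1 : ℝ) : Matrix m n ℝ) a b = ∑ a, ∑ b, A a b + t := by
  simp [Finset.sum_add_distrib, single_apply, ite_and]

theorem elasticPsi_of_nonneg {k N : ℕ} {lam β : ℝ} {U : Matrix (Fin k) (Fin N) ℝ}
    (hU : ∀ i j, 0 ≤ U i j) :
    elasticPsi k N lam β U =
      ((∑ i, ∑ j, U i j + β / (2 * lam) * trace (Uᵀ * U) : ℝ) : EReal) := by
  simp only [elasticPsi, if_pos hU, add_zero, abs_of_nonneg (hU _ _), EReal.coe_add]

theorem elasticPsi_of_not_nonneg {k N : ℕ} {lam β : ℝ} {U : Matrix (Fin k) (Fin N) ℝ}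
    (hU : ¬ ∀ i j, 0 ≤ U i j) : elasticPsi k N lam β U = ⊤ := by
  rw [elasticPsi, if_neg hU, EReal.coe_add_top, EReal.top_add_coe]

/-- A minimizer of the quadratic with leading coefficient `a / 2` and vertex `w` over the
nonnegative half-line is the positive part of `w`. -/
theorem eq_max_zero_of_quadratic_min {a u w : ℝ} (ha : 0 < a) (hu : 0 ≤ u)
    (h : ∀ t, 0 ≤ u + t → 0 ≤ t * (a * (u - w)) + t ^ 2 / 2 * a) : u = max w 0 := by
  have key := h (max w 0 - u) (by simp)
  have key' : 0 ≤ (max w 0 - u) * (u - w) + (max w 0 - u) ^ 2 / 2 :=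
    nonneg_of_mul_nonneg_right (by linarith) ha
  rcases le_total w 0 with hw | hw
  · rw [max_eq_right hw] at key' ⊢
    nlinarith [mul_nonneg hu (neg_nonneg.2 hw)]
  · rw [max_eq_left hw] at key' ⊢
    nlinarith [sq_nonneg (w - u)]

/-- Theorem 2: the entries of `U = prox^Q_{λψ}(Z)` satisfy the
closed-form fixed-point characterization. -/
theorem stmt_7 (k N : ℕ)
    (Q : Matrix (Fin k) (Fin k) ℝ) (hQsymm : Q.IsSymm) (hQpos : Q.PosDef)
    (β lam : ℝ) (hβ : 0 < β) (hlam : 0 < lam)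
    (Z U : Matrix (Fin k) (Fin N) ℝ)
    (hmin : ∀ V : Matrix (Fin k) (Fin N) ℝ,
      ((1 / 2 * Matrix.trace ((U - Z)ᵀ * Q * (U - Z)) : ℝ) : EReal)
          + (lam : EReal) * elasticPsi k N lam β U
        ≤ ((1 / 2 * Matrix.trace ((V - Z)ᵀ * Q * (V - Z)) : ℝ) : EReal)
          + (lam : EReal) * elasticPsi k N lam β V)
    (v : Fin k → Fin N → ℝ)
    (hv : ∀ i j, v i j =
      (lam + ∑ l ∈ Finset.univ.erase i, Q i l * (U l j - Z l j)) / (Q i i + β)) :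
    ∀ i : Fin k, ∀ j : Fin N,
      U i j =
        if Q i i * Z i j > (Q i i + β) * v i j
        then Q i i / (Q i i + β) * Z i j - v i j
        else 0 := by
  have hU : ∀ i j, 0 ≤ U i j := by
    by_contra hneg
    have h := hmin 0
    rw [elasticPsi_of_not_nonneg hneg, elasticPsi_of_nonneg (by simp),
      EReal.coe_mul_top_of_pos hlam, EReal.coe_add_top, ← EReal.coe_mul, ← EReal.coe_add,
      top_le_iff] at h
    exact EReal.coe_ne_top _ h
  intro i j
  have hq : 0 < Q i i := hQpos.diag_pos
  have ha : 0 < Q i i + β := by positivity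
  have hgrad : (Q * (U - Z)) i j = Q i i * (U i j - Z i j) + ((Q i i + β) * v i j - lam) := by
    rw [hv, mul_div_cancel₀ _ ha.ne', Matrix.mul_apply,
      ← Finset.add_sum_erase _ _ (Finset.mem_univ i)]
    simp
  have hu : U i j = max (Q i i / (Q i i + β) * Z i j - v i j) 0 := by
    refine eq_max_zero_of_quadratic_min ha (hU i j) fun t ht => ?_
    have hV : ∀ a b, 0 ≤ (U + t • single i j (1 : ℝ) : Matrix (Fin k) (Fin N) ℝ) a b := by
      intro a b
      by_cases hab : i = a ∧ j = b
      · obtain ⟨rfl, rfl⟩ := hab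
        simpa using ht
      · simpa [single_apply, hab] using hU a b
    have h := hmin (U + t • single i j 1)
    rw [elasticPsi_of_nonneg hU, elasticPsi_of_nonneg hV, ← EReal.coe_mul, ← EReal.coe_mul,
      ← EReal.coe_add, ← EReal.coe_add, EReal.coe_le_coe_iff, add_sub_right_comm,
      trace_transpose_mul_mul_add_smul_single hQsymm, sum_sum_add_smul_single, hgrad] at h
    have hfrob := trace_transpose_mul_mul_add_smul_single (isSymm_one (α := ℝ)) U t i j
    simp only [Matrix.mul_one, Matrix.one_mul, one_apply_eq] at hfrob
    rw [hfrob] at h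
    have hβlam : lam * (β / (2 * lam)) = β / 2 := by field_simp
    have hvertex : (Q i i + β) * (U i j - (Q i i / (Q i i + β) * Z i j - v i j)) =
        (Q i i + β) * U i j - Q i i * Z i j + (Q i i + β) * v i j := by
      field_simp
      ring
    rw [hvertex]
    simp only [mul_add lam, ← mul_assoc lam, hβlam] at h
    linarith
  have hiff : Q i i * Z i j > (Q i i + β) * v i j ↔
      0 < Q i i / (Q i i + β) * Z i j - v i j := by
    rw [gt_iff_lt, sub_pos, div_mul_eq_mul_div, lt_div_iff₀' ha]
  rw [hu]
  split_ifs with hpos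
  · exact max_eq_left (hiff.1 hpos).le
  · exact max_eq_right (not_lt.1 fun h => hpos (hiff.2 h))
end

section
/- Let D be a real m×k matrix, α > 0, λ > 0, d ∈ ℝ^k, and let ψ : ℝ^k → (−∞,+∞] be a proper lower semicontinuous convex function. Set Q = DᵀD + αI, F = Q⁻¹Dᵀ, c = Q⁻¹d. Then the synthesis sparse-coding operator M_D, which maps x ∈ ℝ^m to the unique minimizer over a ∈ ℝ^k of (1/2)‖x − Da‖² + λψ(a) + (α/2)‖a‖² + dᵀa, can be written as the composition M_D = prox^Q_{λψ} ∘ A, where A : ℝ^m → ℝ^k is the affine map A(x) = Fx − c; i.e., a synthesis dictionary model is equivalent to an analysis (transform) model with analysis operator F, bias c, and activation given by the proximity operator of λψ in the metric Q. -/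
open Matrix

theorem exists_affine_norm_minorant {E : Type*} [NormedAddCommGroup E] [NormedSpace ℝ E]
    [ProperSpace E] (ψ : E → EReal) (hbot : ∀ a, ψ a ≠ ⊥) (hproper : ∃ a, ψ a ≠ ⊤)
    (hlsc : LowerSemicontinuous ψ)
    (hconv : ∀ a b : E, ∀ t : ℝ, 0 ≤ t → t ≤ 1 →
      ψ (t • a + (1 - t) • b) ≤ (t : EReal) * ψ a + ((1 - t : ℝ) : EReal) * ψ b) :
    ∃ r s : ℝ, ∀ a, ((r - s * ‖a‖ : ℝ) : EReal) ≤ ψ a := by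
  obtain ⟨a₀, ha₀⟩ := hproper
  obtain ⟨y, hy, hmin⟩ := (hlsc.lowerSemicontinuousOn _).exists_isMinOn
    (Metric.nonempty_closedBall.2 zero_le_one) (isCompact_closedBall a₀ (1 : ℝ))
  rw [isMinOn_iff] at hmin
  have hy₀ : ψ y ≤ ψ a₀ := hmin a₀ (by simp)
  lift ψ a₀ to ℝ using ⟨ha₀, hbot a₀⟩ with r hr
  lift ψ y to ℝ using ⟨ne_top_of_le_ne_top (EReal.coe_ne_top r) hy₀, hbot y⟩ with v hv
  have hvr : v ≤ r := by exact_mod_cast hy₀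
  refine ⟨r - (r - v) * (1 + ‖a₀‖), r - v, fun a => ?_⟩
  have htri : ‖a - a₀‖ ≤ ‖a‖ + ‖a₀‖ := norm_sub_le a a₀
  have hmul := mul_le_mul_of_nonneg_left htri (sub_nonneg.2 hvr)
  rcases le_or_gt ‖a - a₀‖ 1 with hle | hgt
  · refine le_trans ?_ (hmin a (by simpa [dist_eq_norm] using hle))
    have : 0 ≤ (r - v) * (‖a‖ + ‖a₀‖) := by
      have := sub_nonneg.2 hvr
      positivity
    exact_mod_cast (by linarith : r - (r - v) * (1 + ‖a₀‖) - (r - v) * ‖a‖ ≤ v)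
  · by_cases hat : ψ a = ⊤
    · simp [hat]
    lift ψ a to ℝ using ⟨hat, hbot a⟩ with p hp
    set R := ‖a - a₀‖ with hR
    have hR0 : 0 < R := by linarith
    have h := hconv a a₀ R⁻¹ (by positivity) (inv_le_one_of_one_le₀ hgt.le)
    have hb : R⁻¹ • a + (1 - R⁻¹) • a₀ ∈ Metric.closedBall a₀ 1 := by
      have : R⁻¹ • a + (1 - R⁻¹) • a₀ - a₀ = R⁻¹ • (a - a₀) := by module
      rw [Metric.mem_closedBall, dist_eq_norm, this, norm_smul, ← hR, Real.norm_of_nonneg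
        (by positivity), inv_mul_cancel₀ hR0.ne']
    have h' := (hmin _ hb).trans h
    rw [← hp, ← hr] at h'
    have h'' : v ≤ R⁻¹ * p + (1 - R⁻¹) * r := by exact_mod_cast h'
    have h3 : R * v ≤ p + (R - 1) * r := by
      calc R * v ≤ R * (R⁻¹ * p + (1 - R⁻¹) * r) := by gcongr
        _ = p + (R - 1) * r := by field_simp
    exact_mod_cast (by nlinarith : r - (r - v) * (1 + ‖a₀‖) - (r - v) * ‖a‖ ≤ p)

theorem exists_minimizer_add_of_quadratic_growth {E : Type*} [NormedAddCommGroup E]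
    [NormedSpace ℝ E] [ProperSpace E] (ψ : E → EReal) (hbot : ∀ a, ψ a ≠ ⊥)
    (hproper : ∃ a, ψ a ≠ ⊤) (hlsc : LowerSemicontinuous ψ)
    (hconv : ∀ a b : E, ∀ t : ℝ, 0 ≤ t → t ≤ 1 →
      ψ (t • a + (1 - t) • b) ≤ (t : EReal) * ψ a + ((1 - t : ℝ) : EReal) * ψ b)
    {lam : ℝ} (hlam : 0 < lam) (q : E → ℝ) (hq : Continuous q) {β K : ℝ} (hβ : 0 < β)
    (hgrowth : ∀ a, β * ‖a‖ ^ 2 - K * ‖a‖ ≤ q a) :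
    ∃ a, ∀ b, (q a : EReal) + lam * ψ a ≤ (q b : EReal) + lam * ψ b := by
  obtain ⟨r, s, hrs⟩ := exists_affine_norm_minorant ψ hbot hproper hlsc hconv
  obtain ⟨a₀, ha₀⟩ := hproper
  have hL : LowerSemicontinuous fun a => (q a : EReal) + lam * ψ a := by
    refine LowerSemicontinuous.add' (continuous_coe_real_ereal.comp hq).lowerSemicontinuous ?_
      fun x => EReal.continuousAt_add (.inl (EReal.coe_ne_top _)) (.inl (EReal.coe_ne_bot _))
    refine Continuous.comp_lowerSemicontinuous (g := fun y : EReal => (lam : EReal) * y)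
      (continuous_iff_continuousAt.2 fun y => ?_) hlsc
      fun x y h => mul_le_mul_of_nonneg_left h (by exact_mod_cast hlam.le)
    exact EReal.Tendsto.const_mul Filter.tendsto_id (.inl (EReal.coe_ne_bot _)) (.inl (EReal.coe_ne_top _))
  lift ψ a₀ to ℝ using ⟨ha₀, hbot a₀⟩ with p hp
  set S := (fun a => (q a : EReal) + lam * ψ a) ⁻¹' Set.Iic ((q a₀ + lam * p : ℝ) : EReal)
  have ha₀S : a₀ ∈ S := by
    simp only [S, Set.mem_preimage, Set.mem_Iic, ← hp]
    norm_cast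
  have hcomp : IsCompact S := by
    refine Metric.isCompact_of_isClosed_isBounded (hL.isClosed_preimage _) ?_
    refine isBounded_iff_forall_norm_le.2
      ⟨1 + (|K + lam * s| + |q a₀ + lam * p - lam * r|) / β, fun a ha => ?_⟩
    have ha' : (q a : EReal) + lam * ψ a ≤ ((q a₀ + lam * p : ℝ) : EReal) := ha
    have h1 : (q a : EReal) + lam * ((r - s * ‖a‖ : ℝ) : EReal) ≤ (q a : EReal) + lam * ψ a := by
      gcongr
      exact hrs a
    have h2 : q a + lam * (r - s * ‖a‖) ≤ q a₀ + lam * p := by exact_mod_cast h1.trans ha'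
    have h3 := hgrowth a
    by_contra! hlt
    set A := |K + lam * s|
    set B := |q a₀ + lam * p - lam * r|
    have hA : K + lam * s ≤ A := le_abs_self _
    have hB : q a₀ + lam * p - lam * r ≤ B := le_abs_self _
    have hA0 : 0 ≤ A := abs_nonneg _
    have hB0 : 0 ≤ B := abs_nonneg _
    have h4 : β + (A + B) < β * ‖a‖ := by
      have := mul_lt_mul_of_pos_left hlt hβ
      rwa [mul_add, mul_one, mul_div_cancel₀ _ hβ.ne'] at this
    have hn : 1 < ‖a‖ := lt_of_le_of_lt (by
      have : 0 ≤ (A + B) / β := by positivity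
      linarith) hlt
    have h5 : (K + lam * s) * ‖a‖ ≤ A * ‖a‖ := by gcongr
    have h6 : (β + (A + B)) * ‖a‖ < β * ‖a‖ * ‖a‖ := by gcongr
    have h7 : B * 1 ≤ B * ‖a‖ := by gcongr
    nlinarith
  obtain ⟨a, haS, ha⟩ := (hL.lowerSemicontinuousOn _).exists_isMinOn ⟨a₀, ha₀S⟩ hcomp
  rw [isMinOn_iff] at ha
  refine ⟨a, fun b => ?_⟩
  by_cases hb : b ∈ S
  · exact ha b hb
  · exact le_trans haS (le_of_lt (not_le.1 hb))

theorem minimizer_add_unique {E : Type*} [AddCommGroup E] [Module ℝ E] (ψ : E → EReal)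
    (hbot : ∀ a, ψ a ≠ ⊥) (hproper : ∃ a, ψ a ≠ ⊤)
    (hconv : ∀ a b : E, ∀ t : ℝ, 0 ≤ t → t ≤ 1 →
      ψ (t • a + (1 - t) • b) ≤ (t : EReal) * ψ a + ((1 - t : ℝ) : EReal) * ψ b)
    {lam : ℝ} (hlam : 0 < lam) (q : E → ℝ)
    (hq : ∀ a b, a ≠ b → q ((1 / 2 : ℝ) • a + (1 - 1 / 2 : ℝ) • b) < (q a + q b) / 2)
    {a b : E} (ha : ∀ x, (q a : EReal) + lam * ψ a ≤ (q x : EReal) + lam * ψ x)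
    (hb : ∀ x, (q b : EReal) + lam * ψ b ≤ (q x : EReal) + lam * ψ x) : a = b := by
  obtain ⟨a₀, ha₀⟩ := hproper
  have hfin : ∀ {x : E}, (q x : EReal) + lam * ψ x ≤ (q a₀ : EReal) + lam * ψ a₀ → ψ x ≠ ⊤ := by
    intro x hx hxt
    lift ψ a₀ to ℝ using ⟨ha₀, hbot a₀⟩ with p hp
    rw [hxt, EReal.coe_mul_top_of_pos hlam, EReal.coe_add_top, top_le_iff] at hx
    exact EReal.coe_ne_top (q a₀ + lam * p) (by exact_mod_cast hx)
  by_contra hab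
  have hlt := hq a b hab
  have hc := hconv a b (1 / 2) (by norm_num) (by norm_num)
  have hma := ha ((1 / 2 : ℝ) • a + (1 - 1 / 2 : ℝ) • b)
  have hmb := hb ((1 / 2 : ℝ) • a + (1 - 1 / 2 : ℝ) • b)
  have hfa := hfin (ha a₀)
  have hfb := hfin (hb a₀)
  generalize (1 / 2 : ℝ) • a + (1 - 1 / 2 : ℝ) • b = c at *
  lift ψ a to ℝ using ⟨hfa, hbot a⟩ with u hu
  lift ψ b to ℝ using ⟨hfb, hbot b⟩ with v hv
  have hfc : ψ c ≠ ⊤ := by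
    refine ne_top_of_le_ne_top (EReal.coe_ne_top (1 / 2 * u + (1 - 1 / 2) * v)) ?_
    exact_mod_cast hc
  lift ψ c to ℝ using ⟨hfc, hbot c⟩ with w hw
  have hc' : w ≤ 1 / 2 * u + (1 - 1 / 2) * v := by exact_mod_cast hc
  have hma' : q a + lam * u ≤ q c + lam * w := by exact_mod_cast hma
  have hmb' : q b + lam * v ≤ q c + lam * w := by exact_mod_cast hmb
  nlinarith

theorem sq_norm_le_dotProduct_self {ι : Type*} [Fintype ι] (a : ι → ℝ) :
    ‖a‖ ^ 2 ≤ a ⬝ᵥ a := by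
  have h : ‖a‖ ≤ √(a ⬝ᵥ a) := by
    refine (pi_norm_le_iff_of_nonneg (Real.sqrt_nonneg _)).2 fun i => Real.le_sqrt_of_sq_le ?_
    rw [Real.norm_eq_abs, sq_abs, sq]
    exact Finset.single_le_sum (f := fun i => a i * a i) (fun j _ => mul_self_nonneg (a j))
      (Finset.mem_univ i)
  have h0 : 0 ≤ a ⬝ᵥ a := Finset.sum_nonneg fun i _ => mul_self_nonneg (a i)
  calc ‖a‖ ^ 2 ≤ √(a ⬝ᵥ a) ^ 2 := by gcongr
    _ = a ⬝ᵥ a := Real.sq_sqrt h0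

theorem neg_mul_norm_le_dotProduct {ι : Type*} [Fintype ι] (d a : ι → ℝ) :
    -((∑ i, |d i|) * ‖a‖) ≤ d ⬝ᵥ a := by
  rw [Finset.sum_mul, ← Finset.sum_neg_distrib]
  refine Finset.sum_le_sum fun i _ => ?_
  have h : |a i| ≤ ‖a‖ := norm_le_pi_norm a i
  calc -(|d i| * ‖a‖) ≤ -(|d i| * |a i|) := by gcongr
    _ = -|d i * a i| := by rw [abs_mul]
    _ ≤ d i * a i := neg_abs_le _

theorem isUnit_transpose_mul_self_add_smul_one {m k : Type*} [Fintype m] [Fintype k]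
    [DecidableEq k] (D : Matrix m k ℝ) {α : ℝ} (hα : 0 < α) :
    IsUnit (Dᵀ * D + α • (1 : Matrix k k ℝ)) := by
  have h1 : (Dᵀ * D).PosSemidef := by
    simpa [conjTranspose_eq_transpose_of_trivial] using posSemidef_conjTranspose_mul_self D
  exact (PosDef.posSemidef_add h1 (PosDef.one.smul hα)).isUnit

theorem synthesis_objective_eq_prox_objective {m k : Type*} [Fintype m] [Fintype k]
    [DecidableEq k] (D : Matrix m k ℝ) {α : ℝ} (hα : 0 < α) (d a : k → ℝ) (x : m → ℝ)
    {Q : Matrix k k ℝ} (hQ : Q = Dᵀ * D + α • 1) {z : k → ℝ}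
    (hz : z = (Q⁻¹ * Dᵀ) *ᵥ x - Q⁻¹ *ᵥ d) :
    1 / 2 * ((x - D *ᵥ a) ⬝ᵥ (x - D *ᵥ a)) + α / 2 * (a ⬝ᵥ a) + d ⬝ᵥ a =
      1 / 2 * ((a - z) ⬝ᵥ (Q *ᵥ (a - z))) + (1 / 2 * (x ⬝ᵥ x) - 1 / 2 * (z ⬝ᵥ (Q *ᵥ z))) := by
  have hdet : IsUnit Q.det :=
    (Q.isUnit_iff_isUnit_det).1 (hQ ▸ isUnit_transpose_mul_self_add_smul_one D hα)
  have hQz : Q *ᵥ z = Dᵀ *ᵥ x - d := by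
    rw [hz, mulVec_sub, mulVec_mulVec, mulVec_mulVec, ← Matrix.mul_assoc,
      mul_nonsing_inv _ hdet, Matrix.one_mul, one_mulVec]
  have hsymm : z ⬝ᵥ (Q *ᵥ a) = a ⬝ᵥ (Q *ᵥ z) := by
    have hT : Qᵀ = Q := by simp [hQ, transpose_mul]
    rw [dotProduct_mulVec, ← mulVec_transpose, hT, dotProduct_comm]
  have hQa : a ⬝ᵥ (Q *ᵥ a) = (D *ᵥ a) ⬝ᵥ (D *ᵥ a) + α * (a ⬝ᵥ a) := by
    rw [hQ, add_mulVec, dotProduct_add, ← mulVec_mulVec, dotProduct_mulVec a Dᵀ,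
      vecMul_transpose, smul_mulVec, one_mulVec, dotProduct_smul, smul_eq_mul]
  have hax : a ⬝ᵥ (Dᵀ *ᵥ x) = (D *ᵥ a) ⬝ᵥ x := by
    rw [dotProduct_mulVec, vecMul_transpose]
  simp only [mulVec_sub, dotProduct_sub, sub_dotProduct]
  rw [hsymm, hQa, hQz, dotProduct_sub, hax, dotProduct_comm x (D *ᵥ a), dotProduct_comm d a]
  ring

/-- the synthesis sparse-coding operator `M_D` is well defined and
equals the composition `prox^Q_{λψ} ∘ A` with the affine map `A(x) = Fx - c`:
for every `x` the synthesis objective has a unique minimizer, and a point minimizes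
the synthesis objective iff it minimizes the Q-metric proximal objective at
`Fx - c`. -/
theorem stmt_14 (m k : ℕ)
    (D : Matrix (Fin m) (Fin k) ℝ) (α lam : ℝ) (hα : 0 < α) (hlam : 0 < lam)
    (d : Fin k → ℝ) (ψ : (Fin k → ℝ) → EReal)
    (hψbot : ∀ a, ψ a ≠ ⊥) (hψproper : ∃ a, ψ a ≠ ⊤)
    (hψlsc : LowerSemicontinuous ψ)
    (hψconv : ∀ a b : Fin k → ℝ, ∀ t : ℝ, 0 ≤ t → t ≤ 1 →
      ψ (t • a + (1 - t) • b) ≤ (t : EReal) * ψ a + ((1 - t : ℝ) : EReal) * ψ b)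
    (Q : Matrix (Fin k) (Fin k) ℝ) (hQ : Q = Dᵀ * D + α • 1)
    (F : Matrix (Fin k) (Fin m) ℝ) (hF : F = Q⁻¹ * Dᵀ)
    (c : Fin k → ℝ) (hc : c = Q⁻¹ *ᵥ d)
    (L : (Fin m → ℝ) → (Fin k → ℝ) → EReal)
    (hL : ∀ x a, L x a =
      ((1 / 2 * ((x - D *ᵥ a) ⬝ᵥ (x - D *ᵥ a)) + α / 2 * (a ⬝ᵥ a) + d ⬝ᵥ a : ℝ) : EReal)
        + (lam : EReal) * ψ a)
    (P : (Fin k → ℝ) → (Fin k → ℝ) → EReal)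
    (hP : ∀ z u, P z u =
      ((1 / 2 * ((u - z) ⬝ᵥ (Q *ᵥ (u - z))) : ℝ) : EReal) + (lam : EReal) * ψ u) :
    (∀ x : Fin m → ℝ, ∃! a : Fin k → ℝ, ∀ b : Fin k → ℝ, L x a ≤ L x b)
      ∧ ∀ x : Fin m → ℝ, ∀ a : Fin k → ℝ,
          (∀ b : Fin k → ℝ, L x a ≤ L x b)
            ↔ (∀ b : Fin k → ℝ, P (F *ᵥ x - c) a ≤ P (F *ᵥ x - c) b) := by
  have hkey : ∀ x a, L x a = P (F *ᵥ x - c) a + ((1 / 2 * (x ⬝ᵥ x)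
      - 1 / 2 * ((F *ᵥ x - c) ⬝ᵥ (Q *ᵥ (F *ᵥ x - c))) : ℝ) : EReal) := by
    intro x a
    rw [hL, hP, synthesis_objective_eq_prox_objective D hα d a x hQ (z := F *ᵥ x - c)
      (by rw [hF, hc]), EReal.coe_add, add_right_comm]
  refine ⟨fun x => ?_, fun x a => ?_⟩
  · simp only [hL]
    obtain ⟨a, ha⟩ := exists_minimizer_add_of_quadratic_growth ψ hψbot hψproper hψlsc hψconv hlam
      (fun a => 1 / 2 * ((x - D *ᵥ a) ⬝ᵥ (x - D *ᵥ a)) + α / 2 * (a ⬝ᵥ a) + d ⬝ᵥ a)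
      (by fun_prop) (β := α / 2) (K := ∑ i, |d i|) (by positivity) (fun a => by
        have h1 := neg_mul_norm_le_dotProduct d a
        have h2 := mul_le_mul_of_nonneg_left (sq_norm_le_dotProduct_self a)
          (by positivity : 0 ≤ α / 2)
        have h3 := (sq_nonneg _).trans (sq_norm_le_dotProduct_self (x - D *ᵥ a))
        linarith)
    refine ⟨a, ha, fun b hb => ?_⟩
    refine minimizer_add_unique ψ hψbot hψproper hψconv hlam
      (fun a => 1 / 2 * ((x - D *ᵥ a) ⬝ᵥ (x - D *ᵥ a)) + α / 2 * (a ⬝ᵥ a) + d ⬝ᵥ a)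
      (fun u v huv => ?_) hb ha
    have h1 : 0 < (u - v) ⬝ᵥ (u - v) :=
      lt_of_lt_of_le (pow_pos (norm_pos_iff.2 (sub_ne_zero.2 huv)) 2)
        (sq_norm_le_dotProduct_self _)
    have h2 := (sq_nonneg _).trans (sq_norm_le_dotProduct_self (D *ᵥ u - D *ᵥ v))
    have h3 := mul_pos hα h1
    simp only [mulVec_add, mulVec_smul, dotProduct_add, add_dotProduct, dotProduct_sub,
      sub_dotProduct, dotProduct_smul, smul_dotProduct, smul_eq_mul] at h1 h2 h3 ⊢
    rw [dotProduct_comm v u] at h3 ⊢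
    rw [dotProduct_comm (D *ᵥ v) (D *ᵥ u)] at h2 ⊢
    rw [dotProduct_comm (D *ᵥ u) x, dotProduct_comm (D *ᵥ v) x]
    linarith
  · simp only [hkey]
    exact forall_congr' fun b => (EReal.addLECancellable_coe _).add_le_add_iff_right
end
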